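/- arXiv:2110.04672 — 6 statements merged into one kernel-verified Lean document; each statement's English description precedes it below -/
import Mathlib

section
/- For any group homomorphism a : G → ℤ₂ and any functions m, x ∈ C¹(G, ℤ₂⊕ℤ₂), define σ̃ ∈ C²(G, U(1)⊕U(1)) by σ̃(g,h) := (−1)^{x(g)·m(h)^{a(g)}}. Then for all g, h, k ∈ G one has (−1)^{(d¹ₐx)(g,h)·m(k)^{a(gh)} + x(g)·((d¹ₐm)(h,k))^{a(g)}} = (d²ₐσ̃)(g,h,k). -/
noncomputable section

/-- `ℤ₂ ⊕ ℤ₂`, written additively with componentwise addition. -/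
abbrev Z22 := ZMod 2 × ZMod 2

/-- `U(1) ⊕ U(1)`, written multiplicatively with componentwise multiplication,
where `U(1)` is the circle group. -/
abbrev U12 := Circle × Circle

/-- The `ℤ₂`-action on `ℤ₂ ⊕ ℤ₂`: `x^n = x` if `n = 0` and the swap of the two
components if `n = 1`. -/
def actZ (n : ZMod 2) (x : Z22) : Z22 := if n = 0 then x else (x.2, x.1)

/-- The `ℤ₂`-action on `U(1) ⊕ U(1)`: `x^n = x` if `n = 0` and the swap of the two
components if `n = 1`. -/
def actU (n : ZMod 2) (x : U12) : U12 := if n = 0 then x else (x.2, x.1)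

/-- The componentwise product `x·y` in the field `ℤ₂`. -/
def dotZ (x y : Z22) : Z22 := (x.1 * y.1, x.2 * y.2)

/-- `-1` as an element of the circle group. -/
def negOneC : Circle := ⟨-1, by simp [Submonoid.unitSphere]⟩

/-- `(−1)^x ∈ U(1) ⊕ U(1)` for `x ∈ ℤ₂ ⊕ ℤ₂`, componentwise. -/
def negPow (x : Z22) : U12 := (negOneC ^ x.1.val, negOneC ^ x.2.val)

variable {G : Type*} [Group G]

/-- First twisted coboundary, for `ℤ₂ ⊕ ℤ₂`-valued cochains. -/
def d1Z (a : G → ZMod 2) (x : G → Z22) (g h : G) : Z22 :=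
  actZ (a g) (x h) + x g - x (g * h)

/-- Second twisted coboundary, for `ℤ₂ ⊕ ℤ₂`-valued cochains. -/
def d2Z (a : G → ZMod 2) (y : G → G → Z22) (g h k : G) : Z22 :=
  actZ (a g) (y h k) + y g (h * k) - y (g * h) k - y g h

/-- Second twisted coboundary, for `U(1) ⊕ U(1)`-valued cochains. -/
def d2U (a : G → ZMod 2) (y : G → G → U12) (g h k : G) : U12 :=
  actU (a g) (y h k) * y g (h * k) * (y (g * h) k)⁻¹ * (y g h)⁻¹

theorem actZ_add_left (n p : ZMod 2) (x : Z22) : actZ (n + p) x = actZ n (actZ p x) := by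
  revert n p x
  decide

theorem actZ_add (n : ZMod 2) (x y : Z22) : actZ n (x + y) = actZ n x + actZ n y := by
  unfold actZ
  split_ifs <;> rfl

theorem actZ_sub (n : ZMod 2) (x y : Z22) : actZ n (x - y) = actZ n x - actZ n y := by
  unfold actZ
  split_ifs <;> rfl

theorem actZ_mul (n : ZMod 2) (x y : Z22) : actZ n (x * y) = actZ n x * actZ n y := by
  unfold actZ
  split_ifs <;> rfl

theorem dotZ_eq_mul (x y : Z22) : dotZ x y = x * y := rfl

theorem negOneC_sq : negOneC ^ 2 = 1 := by
  apply Circle.ext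
  rw [Circle.coe_pow, Circle.coe_one]
  exact neg_one_sq

theorem negOneC_pow_val_add (u v : ZMod 2) :
    negOneC ^ (u + v).val = negOneC ^ u.val * negOneC ^ v.val := by
  rw [ZMod.val_add, ← pow_add]
  exact (pow_eq_pow_mod _ negOneC_sq).symm

theorem negPow_add (x y : Z22) : negPow (x + y) = negPow x * negPow y :=
  Prod.ext (negOneC_pow_val_add _ _) (negOneC_pow_val_add _ _)

theorem negPow_sub (x y : Z22) : negPow (x - y) = negPow x * (negPow y)⁻¹ := by
  rw [eq_mul_inv_iff_mul_eq, ← negPow_add, sub_add_cancel]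

theorem negPow_actZ (n : ZMod 2) (x : Z22) : negPow (actZ n x) = actU n (negPow x) := by
  unfold actZ actU
  split_ifs <;> rfl

theorem negPow_d2Z (a : G → ZMod 2) (y : G → G → Z22) (g h k : G) :
    negPow (d2Z a y g h k) = d2U a (fun g' h' => negPow (y g' h')) g h k := by
  simp only [d2Z, d2U, negPow_sub, negPow_add, negPow_actZ]

/-- The graded Leibniz rule for the cup product of two twisted 1-cochains. -/
theorem d1Z_dotZ_add_dotZ_d1Z (a : G → ZMod 2) (ha : ∀ g h, a (g * h) = a g + a h)
    (m x : G → Z22) (g h k : G) :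
    dotZ (d1Z a x g h) (actZ (a (g * h)) (m k)) + dotZ (x g) (actZ (a g) (d1Z a m h k)) =
      d2Z a (fun g' h' => dotZ (x g') (actZ (a g') (m h'))) g h k := by
  have two_eq_zero : (2 : Z22) = 0 := rfl
  simp only [d1Z, d2Z, ha, actZ_add_left, actZ_add, actZ_sub, actZ_mul, dotZ_eq_mul]
  linear_combination (x g * actZ (a g) (actZ (a h) (m k)) + x g * actZ (a g) (m h) -
    x g * actZ (a g) (m (h * k))) * two_eq_zero

/-- **Lemma 2.2.** For a group homomorphism `a : G → ℤ₂` and `m, x ∈ C¹(G, ℤ₂⊕ℤ₂)`,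
setting `σ̃(g,h) := (−1)^{x(g)·m(h)^{a(g)}}`, one has
`(−1)^{(d¹ₐx)(g,h)·m(k)^{a(gh)} + x(g)·((d¹ₐm)(h,k))^{a(g)}} = (d²ₐσ̃)(g,h,k)`. -/
theorem negPow_d1_dot_eq_d2U (a : G → ZMod 2) (ha : ∀ g h, a (g * h) = a g + a h)
    (m x : G → Z22) (g h k : G) :
    negPow (dotZ (d1Z a x g h) (actZ (a (g * h)) (m k)) +
        dotZ (x g) (actZ (a g) (d1Z a m h k))) =
      d2U a (fun g' h' => negPow (dotZ (x g') (actZ (a g') (m h')))) g h k := by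
  rw [d1Z_dotZ_add_dotZ_d1Z a ha, negPow_d2Z]
end
end

section
/- The relation ∼_{PD(G)} is an equivalence relation on the set PD̃(G) of admissible pentads: it is reflexive, symmetric, and transitive. -/
noncomputable section

variable {G : Type*} [Group G]

/-- Third twisted coboundary, for `U(1) ⊕ U(1)`-valued cochains. -/
def d3U (a : G → ZMod 2) (z : G → G → G → U12) (g h k f : G) : U12 :=
  actU (a g) (z h k f) * z g (h * k) f * z g h k *
    (z (g * h) k f)⁻¹ * (z g h (k * f))⁻¹

/-- A pentad `(c, κ_R, κ_L, b, a)`. -/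
structure Pentad (G : Type*) [Group G] where
  c : G → G → G → U12
  kR : G → G → Z22
  kL : G → G → Z22
  b : G → Z22
  a : G → ZMod 2

/-- Membership in `PD̃(G)`: `a` is a group homomorphism into `ℤ₂`,
`d¹ₐ b = κ_L + κ_R`, `d²ₐ κ_R = 0`, `d²ₐ κ_L = 0` and
`d³ₐ c(g,h,k,f) = (−1)^{κ_L(g,h)·κ_R(k,f)^{a(gh)}}`. -/
def Pentad.Admissible (P : Pentad G) : Prop :=
  (∀ g h : G, P.a (g * h) = P.a g + P.a h) ∧
  (∀ g h : G, d1Z P.a P.b g h = P.kL g h + P.kR g h) ∧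
  (∀ g h k : G, d2Z P.a P.kR g h k = 0) ∧
  (∀ g h k : G, d2Z P.a P.kL g h k = 0) ∧
  (∀ g h k f : G, d3U P.a P.c g h k f =
    negPow (dotZ (P.kL g h) (actZ (P.a (g * h)) (P.kR k f))))

/-- The relation `∼_{PD(G)}` on pentads. -/
def PDRel (P Q : Pentad G) : Prop :=
  P.a = Q.a ∧
  ∃ m : G → Z22, ∃ σ : G → G → U12,
    (∀ g h : G, Q.kR g h = d1Z P.a m g h + P.kR g h) ∧
    (∀ g h : G, Q.kL g h =
      d1Z P.a Q.b g h - d1Z P.a P.b g h - d1Z P.a m g h + P.kL g h) ∧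
    (∀ g h k : G, Q.c g h k =
      negPow (dotZ (P.kL g h) (actZ (P.a (g * h)) (m k))) *
      negPow (dotZ (Q.b g - P.b g - m g) (actZ (P.a g) (Q.kR h k))) *
      d2U P.a σ g h k * P.c g h k)

theorem actZ_zero (n : ZMod 2) : actZ n 0 = 0 := by
  unfold actZ; split <;> rfl

theorem actZ_actZ (n k : ZMod 2) (x : Z22) : actZ n (actZ k x) = actZ (n + k) x := by
  revert n k x; decide

theorem actU_mul (n : ZMod 2) (x y : U12) : actU n (x * y) = actU n x * actU n y := by
  unfold actU; split <;> rfl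

theorem actU_inv (n : ZMod 2) (x : U12) : actU n x⁻¹ = (actU n x)⁻¹ := by
  unfold actU; split <;> rfl

theorem actU_one (n : ZMod 2) : actU n 1 = 1 := by
  unfold actU; split <;> rfl

theorem actU_negPow (n : ZMod 2) (x : Z22) : actU n (negPow x) = negPow (actZ n x) := by
  unfold actU actZ; split <;> rfl

theorem negOneC_pow_val_add_s1 (x y : ZMod 2) :
    negOneC ^ (x + y).val = negOneC ^ x.val * negOneC ^ y.val := by
  rw [ZMod.val_add, ← pow_add, ← pow_mod_orderOf, Nat.mod_mod_of_dvd _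
    (orderOf_dvd_of_pow_eq_one negOneC_sq), pow_mod_orderOf]

theorem negPow_zero : negPow 0 = 1 := by
  simp [negPow]

theorem negPow_inv (x : Z22) : (negPow x)⁻¹ = negPow x :=
  inv_eq_of_mul_eq_one_left <| by rw [← negPow_add, CharTwo.add_self_eq_zero, negPow_zero]

theorem d2U_mul (a : G → ZMod 2) (σ τ : G → G → U12) (g h k : G) :
    d2U a (fun g h => σ g h * τ g h) g h k = d2U a σ g h k * d2U a τ g h k := by
  simp only [d2U, actU_mul, mul_inv]; ac_rfl

theorem d2U_inv (a : G → ZMod 2) (σ : G → G → U12) (g h k : G) :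
    d2U a (fun g h => (σ g h)⁻¹) g h k = (d2U a σ g h k)⁻¹ := by
  simp only [d2U, actU_inv, mul_inv]

/-- The Leibniz rule for the twisted cup product of two `ℤ₂ ⊕ ℤ₂`-valued 1-cochains. -/
theorem d2U_negPow_cup {a : G → ZMod 2} (ha : ∀ g h, a (g * h) = a g + a h)
    (x y : G → Z22) (g h k : G) :
    d2U a (fun g h => negPow (x g * actZ (a g) (y h))) g h k =
      negPow (d1Z a x g h * actZ (a (g * h)) (y k) + x g * actZ (a g) (d1Z a y h k)) := by
  simp only [d2U, actU_negPow, negPow_inv, ← negPow_add, d1Z, actZ_add, actZ_sub, actZ_mul,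
    actZ_actZ, ha]
  congr 1
  linear_combination (x (g * h) * actZ (a g + a h) (y k) + x g * actZ (a g) (y (h * k)) -
    x g * actZ (a g + a h) (y k)) *
    CharTwo.two_eq_zero (R := Z22)

theorem d1Z_add (a : G → ZMod 2) (x y : G → Z22) (g h : G) :
    d1Z a (fun g => x g + y g) g h = d1Z a x g h + d1Z a y g h := by
  simp only [d1Z, actZ_add]; abel

theorem d1Z_sub (a : G → ZMod 2) (x y : G → Z22) (g h : G) :
    d1Z a (fun g => x g - y g) g h = d1Z a x g h - d1Z a y g h := by
  simp only [d1Z, actZ_sub]; abel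

theorem PDRel.refl (P : Pentad G) : PDRel P P := by
  refine ⟨rfl, 0, 1, ?_, ?_, ?_⟩ <;> intros <;>
    simp [d1Z, d2U, dotZ_eq_mul, actZ_zero, actU_one, negPow_zero]

theorem PDRel.symm {P Q : Pentad G} (hP : ∀ g h, P.a (g * h) = P.a g + P.a h)
    (hPQ : PDRel P Q) : PDRel Q P := by
  obtain ⟨ha, m, σ, hR, hL, hc⟩ := hPQ
  refine ⟨ha.symm, m, fun g h =>
    (σ g h)⁻¹ * negPow ((Q.b g - P.b g - m g) * actZ (P.a g) (m h)), ?_, ?_, ?_⟩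
  · intro g h
    rw [← ha, hR, ← add_assoc, CharTwo.add_self_eq_zero, zero_add]
  · intro g h
    rw [← ha, hL]
    linear_combination CharTwo.add_self_eq_zero (d1Z P.a m g h)
  · intro g h k
    rw [← ha, d2U_mul, d2U_inv, d2U_negPow_cup hP, d1Z_sub, d1Z_sub, hc, hL, hR]
    simp only [dotZ_eq_mul, actZ_add]
    have regroup (u v w x y : Z22) (huv : u + v + w + x + y = 0) (s c : U12) :
        c = negPow u * negPow v * (s⁻¹ * negPow w) * (negPow x * negPow y * s * c) :=
      calc c = negPow (u + v + w + x + y) * (s⁻¹ * s * c) := by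
            rw [huv, negPow_zero, inv_mul_cancel, one_mul, one_mul]
        _ = _ := by simp only [negPow_add]; ac_rfl
    apply regroup
    linear_combination
      ((d1Z P.a Q.b g h - d1Z P.a P.b g h - d1Z P.a m g h + P.kL g h) *
        actZ (P.a (g * h)) (m k) + (Q.b g - P.b g - m g) * actZ (P.a g) (d1Z P.a m h k) -
        m g * actZ (P.a g) (P.kR h k)) * CharTwo.two_eq_zero (R := Z22)

theorem PDRel.trans {P Q R : Pentad G} (hP : ∀ g h, P.a (g * h) = P.a g + P.a h)
    (hPQ : PDRel P Q) (hQR : PDRel Q R) : PDRel P R := by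
  obtain ⟨ha, m, σ, hR, hL, hc⟩ := hPQ
  obtain ⟨ha', m', σ', hR', hL', hc'⟩ := hQR
  rw [← ha] at hR' hL' hc'
  refine ⟨ha.trans ha', fun g => m g + m' g, fun g h =>
    σ g h * σ' g h * negPow ((Q.b g - P.b g - m g) * actZ (P.a g) (m' h)), ?_, ?_, ?_⟩
  · intro g h
    rw [hR', hR, d1Z_add, add_assoc, add_left_comm]
  · intro g h
    rw [hL', hL, d1Z_add]
    ring
  · intro g h k
    rw [hc', hc, d2U_mul, d2U_mul, d2U_negPow_cup hP, d1Z_sub, d1Z_sub, hL, hR', hR]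
    simp only [dotZ_eq_mul, actZ_add]
    have regroup (u v w x y z t : Z22) (huv : u + v + w + x = y + z + t) (s s' c : U12) :
        negPow u * negPow v * s' * (negPow w * negPow x * s * c) =
          negPow y * negPow z * (s * s' * negPow t) * c :=
      calc _ = negPow (u + v + w + x) * (s * s' * c) := by simp only [negPow_add]; ac_rfl
        _ = _ := by rw [huv]; simp only [negPow_add]; ac_rfl
    apply regroup
    linear_combination
      -(Q.b g - P.b g - m g) * actZ (P.a g) (d1Z P.a m' h k) * CharTwo.two_eq_zero (R := Z22)

/-- **Lemma 2.2.** `∼_{PD(G)}` is an equivalence relation on `PD̃(G)`: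
it is reflexive, symmetric and transitive. -/
theorem pdRel_equivalence (G : Type*) [Group G] :
    (∀ P : Pentad G, P.Admissible → PDRel P P) ∧
    (∀ P Q : Pentad G, P.Admissible → Q.Admissible → PDRel P Q → PDRel Q P) ∧
    (∀ P Q R : Pentad G, P.Admissible → Q.Admissible → R.Admissible →
      PDRel P Q → PDRel Q R → PDRel P R) :=
  ⟨fun P _ => PDRel.refl P, fun _ _ hP _ h => h.symm hP.1,
    fun _ _ _ hP _ _ h h' => h.trans hP.1 h'⟩
end
end

section
/- Let (c,κ_R,κ_L,b,a) ∈ PD̃(G) and define c̃ ∈ C³(G,U(1)⊕U(1)) by c̃(g,h,k) := (−1)^{b(g)·κ_R(h,k)^{a(g)}} · c(g,h,k). Then (c,κ_R,κ_L,b,a) ∼_{PD(G)} (c̃,κ_R,κ_R,0,a); in fact the relation holds with witness pair (m,σ) = (0,1). -/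
noncomputable section

variable {G : Type*} [Group G]

/-- The data `(c, κ_R, κ_L, b)` of a pentad with twist `a` kept separate. -/
structure PentadData (G : Type*) where
  c : G → G → G → U12
  kR : G → G → Z22
  kL : G → G → Z22
  b : G → Z22

/-- `(c, κ_R, κ_L, b, a) ∈ PD̃(G)`: `a` is a group homomorphism into `ℤ₂`,
`d¹ₐ b = κ_L + κ_R`, `d²ₐ κ_R = 0`, `d²ₐ κ_L = 0` and
`d³ₐ c(g,h,k,f) = (−1)^{κ_L(g,h)·κ_R(k,f)^{a(gh)}}`. -/
def IsPentad (a : G → ZMod 2) (P : PentadData G) : Prop :=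
  (∀ g h : G, a (g * h) = a g + a h) ∧
  (∀ g h : G, d1Z a P.b g h = P.kL g h + P.kR g h) ∧
  (∀ g h k : G, d2Z a P.kR g h k = 0) ∧
  (∀ g h k : G, d2Z a P.kL g h k = 0) ∧
  (∀ g h k f : G, d3U a P.c g h k f =
    negPow (dotZ (P.kL g h) (actZ (a (g * h)) (P.kR k f))))

/-- `P ∼_{PD(G)} Q` with witness pair `(m, σ)`. -/
def RelW (a : G → ZMod 2) (P Q : PentadData G) (m : G → Z22)
    (σ : G → G → U12) : Prop :=
  (∀ g h : G, Q.kR g h = d1Z a m g h + P.kR g h) ∧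
  (∀ g h : G, Q.kL g h =
    d1Z a Q.b g h - d1Z a P.b g h - d1Z a m g h + P.kL g h) ∧
  (∀ g h k : G, Q.c g h k =
    negPow (dotZ (P.kL g h) (actZ (a (g * h)) (m k))) *
    negPow (dotZ (Q.b g - P.b g - m g) (actZ (a g) (Q.kR h k))) *
    d2U a σ g h k * P.c g h k)

/-- The modified 3-cochain `c̃(g,h,k) := (−1)^{b(g)·κ_R(h,k)^{a(g)}} · c(g,h,k)`. -/
def ctilde (a : G → ZMod 2) (P : PentadData G) (g h k : G) : U12 :=
  negPow (dotZ (P.b g) (actZ (a g) (P.kR h k))) * P.c g h k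

/-- `P ∼_{PD(G)} Q` (existence of a witness pair). -/
def PDGRel (a : G → ZMod 2) (P Q : PentadData G) : Prop :=
  ∃ m : G → Z22, ∃ σ : G → G → U12, RelW a P Q m σ

theorem dotZ_zero (x : Z22) : dotZ x 0 = 0 := by
  simp [dotZ]

theorem Z22.add_self (x : Z22) : x + x = 0 :=
  Prod.ext (CharTwo.add_self_eq_zero x.1) (CharTwo.add_self_eq_zero x.2)

theorem Z22.neg_eq (x : Z22) : -x = x :=
  neg_eq_of_add_eq_zero_left (Z22.add_self x)

theorem d1Z_zero (a : G → ZMod 2) (g h : G) : d1Z a (fun _ => 0) g h = 0 := by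
  simp [d1Z, actZ_zero]

theorem d2U_one (a : G → ZMod 2) (g h k : G) : d2U a (fun _ _ => 1) g h k = 1 := by
  have hact : actU (a g) 1 = 1 := by
    unfold actU
    split_ifs <;> rfl
  simp [d2U, hact]

theorem relW_ctilde (a : G → ZMod 2) (P : PentadData G) (hP : IsPentad a P) :
    RelW a P ⟨ctilde a P, P.kR, P.kR, 0⟩ (fun _ => 0) (fun _ _ => 1) := by
  refine ⟨fun g h => ?_, fun g h => ?_, fun g h k => ?_⟩
  · simp [d1Z_zero]
  · have h0 : d1Z a (0 : G → Z22) g h = 0 := d1Z_zero a g h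
    simp only [h0, d1Z_zero, hP.2.1, zero_sub, sub_zero, Z22.neg_eq]
    rw [add_right_comm, Z22.add_self, zero_add]
  · simp [ctilde, actZ_zero, dotZ_zero, negPow_zero, d2U_one, Z22.neg_eq]

/-- **Lemma 2.3 (second part).** For `(c,κ_R,κ_L,b,a) ∈ PD̃(G)` and
`c̃(g,h,k) := (−1)^{b(g)·κ_R(h,k)^{a(g)}}·c(g,h,k)`, one has
`(c,κ_R,κ_L,b,a) ∼_{PD(G)} (c̃,κ_R,κ_R,0,a)`; in fact the relation holds with
witness pair `(m,σ) = (0,1)`. -/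
theorem rel_ctilde (a : G → ZMod 2) (P : PentadData G) (hP : IsPentad a P) :
    PDGRel a P ⟨ctilde a P, P.kR, P.kR, 0⟩ ∧
    RelW a P ⟨ctilde a P, P.kR, P.kR, 0⟩ (fun _ => 0) (fun _ _ => 1) := by
  exact ⟨⟨_, _, relW_ctilde a P hP⟩, relW_ctilde a P hP⟩
end
end

section
/- Let H be a complex Hilbert space, M a von Neumann algebra acting on H, and Γ ∈ B(H) a self-adjoint unitary with ΓMΓ = M. Write M⁰ := {x ∈ M : ΓxΓ = x} for the even part, and call x ∈ M odd if ΓxΓ = −x. Assume (M, Ad Γ) is balanced, i.e. there is an odd self-adjoint unitary U ∈ M, and central, i.e. every element of M⁰ that commutes with every element of M is a scalar multiple of the identity. Then for every projection z ∈ M⁰ that commutes with every element of M⁰ and satisfies z ≠ 0 and z ≠ 1, one has U z U = 1 − z. -/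
/-- If `z` commutes with `y` and `u * y * u`, where `u` is an involution, then `u * z * u`
commutes with `y`. -/
theorem commute_involution_conj {A : Type*} [Ring A] {u y z : A} (hu : u * u = 1)
    (h : Commute z (u * y * u)) : Commute (u * z * u) y := by
  calc u * z * u * y = u * (z * (u * y * u)) * u := by simp [mul_assoc, hu]
    _ = u * (u * y * u * z) * u := by rw [h.eq]
    _ = y * (u * z * u) := by simp [← mul_assoc, hu]

/-- The sum of an element and its conjugate under an involution `u` commutes with `u`. -/
theorem commute_add_involution_conj {A : Type*} [Ring A] {u : A} (z : A) (hu : u * u = 1) :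
    Commute (z + u * z * u) u := by
  calc (z + u * z * u) * u = z * u + u * z := by simp [add_mul, mul_assoc, hu]
    _ = u * (z + u * z * u) := by simp [mul_add, ← mul_assoc, hu, add_comm]

/-- If the idempotents `z` and `w` have scalar sum and `z` is neither `0` nor `1`, then
they are complementary. -/
theorem IsIdempotentElem.eq_one_sub_of_add_eq_smul_one {K A : Type*} [Field K] [CharZero K]
    [Ring A] [Algebra K A] {z w : A} (hz : IsIdempotentElem z) (hw : IsIdempotentElem w)
    (hz0 : z ≠ 0) (hz1 : z ≠ 1) {c : K} (h : z + w = c • (1 : A)) : w = 1 - z := by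
  have hwz : w = c • (1 : A) - z := eq_sub_of_add_eq' h
  have hprod : (c - 1) • (c • (1 : A) - (2 : K) • z) = 0 := by
    have hww := hw.eq
    rw [hwz] at hww
    simp only [sub_mul, mul_sub, smul_mul_assoc, mul_smul_comm, one_mul, mul_one, hz.eq] at hww
    rw [← sub_eq_zero] at hww
    rw [← hww]
    module
  rcases smul_eq_zero.mp hprod with hc | hc
  · rw [hwz, sub_eq_zero.mp hc, one_smul]
  · have hzc : z = (c / 2) • (1 : A) := by
      rw [div_eq_inv_mul, mul_smul, sub_eq_zero.mp hc, inv_smul_smul₀ two_ne_zero]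
    have hscalar : (c / 2) • (z - 1) = 0 := by
      calc (c / 2) • (z - 1) = ((c / 2) • (1 : A)) * z - (c / 2) • (1 : A) := by
            simp [smul_sub]
        _ = 0 := by rw [← hzc, hz.eq, sub_self]
    rcases smul_eq_zero.mp hscalar with h0 | h1
    · exact absurd (by rw [hzc, h0, zero_smul]) hz0
    · exact absurd (sub_eq_zero.mp h1) hz1

/-- **(from Lemma B.1 / Proposition 2.9 argument).** Let `M` be a von Neumann algebra
on a Hilbert space `H` and `Γ` a self-adjoint unitary with `Γ M Γ = M`, grading `M` by
`Ad Γ`. Assume `(M, Ad Γ)` is balanced, with odd self-adjoint unitary `U ∈ M`, and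
central (every even element of `M` commuting with all of `M` is scalar). Then every
nontrivial projection `z` in the center of the even part `M⁰` satisfies
`U z U = 1 - z`. -/
theorem central_projection_flip {H : Type*} [NormedAddCommGroup H]
    [InnerProductSpace ℂ H] [CompleteSpace H]
    (M : VonNeumannAlgebra H) (Γ : H →L[ℂ] H)
    (hΓsa : star Γ = Γ) (hΓu : Γ * Γ = 1)
    (hΓM : ∀ x : H →L[ℂ] H, x ∈ M ↔ Γ * x * Γ ∈ M)
    (U : H →L[ℂ] H) (hUM : U ∈ M) (hUsa : star U = U) (hUu : U * U = 1)
    (hUodd : Γ * U * Γ = -U)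
    (hcentral : ∀ x : H →L[ℂ] H, x ∈ M → Γ * x * Γ = x →
      (∀ y ∈ M, x * y = y * x) → ∃ c : ℂ, x = c • (1 : H →L[ℂ] H))
    (z : H →L[ℂ] H) (hzM : z ∈ M) (hzeven : Γ * z * Γ = z)
    (hzsa : star z = z) (hz2 : z * z = z)
    (hzcomm : ∀ y : H →L[ℂ] H, y ∈ M → Γ * y * Γ = y → z * y = y * z)
    (hz0 : z ≠ 0) (hz1 : z ≠ 1) :
    U * z * U = 1 - z := by
  have conj_mul (a b : H →L[ℂ] H) : Γ * (a * b) * Γ = (Γ * a * Γ) * (Γ * b * Γ) := by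
    simp only [mul_assoc, ← mul_assoc Γ Γ, hΓu, one_mul]
  have conj_conj (a : H →L[ℂ] H) : Γ * (Γ * a * Γ) * Γ = a := by
    simp only [← mul_assoc, hΓu, one_mul]
    rw [mul_assoc, hΓu, mul_one]
  have conj_U_mem {x : H →L[ℂ] H} (hx : x ∈ M) : U * x * U ∈ M :=
    mul_mem (mul_mem hUM hx) hUM
  have conj_U_even {x : H →L[ℂ] H} (hx : Γ * x * Γ = x) : Γ * (U * x * U) * Γ = U * x * U := by
    rw [conj_mul, conj_mul, hUodd, hx]
    simp
  have hU : Commute (z + U * z * U) U := commute_add_involution_conj z hUu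
  have heven (y : H →L[ℂ] H) (hy : y ∈ M) (hye : Γ * y * Γ = y) :
      Commute (z + U * z * U) y :=
    Commute.add_left (hzcomm y hy hye) <|
      commute_involution_conj hUu (hzcomm _ (conj_U_mem hy) (conj_U_even hye))
  have hodd (y : H →L[ℂ] H) (hy : y ∈ M) (hyo : Γ * y * Γ = -y) :
      Commute (z + U * z * U) y := by
    have hyU : Commute (z + U * z * U) (y * U) :=
      heven _ (mul_mem hy hUM) (by rw [conj_mul, hUodd, hyo, neg_mul_neg])
    simpa [mul_assoc, hUu] using hyU.mul_right hU
  have hall (y : H →L[ℂ] H) (hy : y ∈ M) : Commute (z + U * z * U) y := by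
    have hy' : Γ * y * Γ ∈ M := (hΓM y).mp hy
    have h := (heven (y + Γ * y * Γ) (add_mem hy hy')
        (by rw [mul_add, add_mul, conj_conj, add_comm])).add_right
      (hodd (y - Γ * y * Γ) (sub_mem hy hy') (by rw [mul_sub, sub_mul, conj_conj, neg_sub]))
    have hsum : (y + Γ * y * Γ) + (y - Γ * y * Γ) = (2 : ℂ) • y := by module
    rw [hsum] at h
    simpa using h.smul_right (2 : ℂ)⁻¹
  obtain ⟨c, hc⟩ := hcentral (z + U * z * U) (add_mem hzM (conj_U_mem hzM))
    (by rw [mul_add, add_mul, hzeven, conj_U_even hzeven]) fun y hy => (hall y hy).eq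
  have hw : IsIdempotentElem (U * z * U) := by
    calc U * z * U * (U * z * U) = U * (z * (U * U) * z) * U := by simp only [mul_assoc]
      _ = U * z * U := by rw [hUu, mul_one, hz2]
  exact IsIdempotentElem.eq_one_sub_of_add_eq_smul_one hz2 hw hz0 hz1 hc
end

section
/- Let H be a complex Hilbert space, M a von Neumann algebra acting on H, and Γ ∈ B(H) a self-adjoint unitary with ΓMΓ = M. Write M⁰ := {x ∈ M : ΓxΓ = x} for the even part. Assume (M, Ad Γ) is balanced, with odd self-adjoint unitary U ∈ M, and central. Suppose there exists a projection z ∈ M⁰ that commutes with every element of M⁰ and satisfies z ≠ 0, z ≠ 1. Then every projection s ∈ M⁰ that commutes with every element of M⁰ satisfies s ∈ {0, 1, z, 1 − z}; i.e. the projections of the center of M⁰ are exactly 0, 1, z and 1−z. -/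
/-- Elements that are odd for conjugation by an involution anticommute with it. -/
theorem mul_eq_neg_mul_of_conj_eq_neg {A : Type*} [Ring A] {Γ U : A} (hΓ : Γ * Γ = 1)
    (hUodd : Γ * U * Γ = -U) : Γ * U = -(U * Γ) := by
  calc Γ * U = Γ * U * Γ * Γ := by rw [mul_assoc (Γ * U), hΓ, mul_one]
    _ = -(U * Γ) := by rw [hUodd, neg_mul]

/-- An idempotent multiple of the identity is `0` or `1`. -/
theorem eq_zero_or_eq_one_of_mul_self_of_eq_smul_one {A : Type*} [Ring A] [Algebra ℂ A]
    {x : A} (hx : x * x = x) (hscalar : ∃ c : ℂ, x = c • (1 : A)) : x = 0 ∨ x = 1 := by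
  obtain ⟨c, rfl⟩ := hscalar
  by_cases hc : c = 0
  · left; simp [hc]
  · right
    have h : c • (c • (1 : A)) = c • (1 : A) := by simpa using hx
    exact smul_right_injective A hc h

/-- An element commuting with the even part and with an odd involution commutes with the
whole graded algebra. -/
theorem mul_comm_of_mul_comm_even_of_mul_comm_odd {A : Type*} [Ring A] [Algebra ℂ A]
    {S : Subalgebra ℂ A} {Γ U x : A} (hΓ : Γ * Γ = 1) (hΓS : ∀ y ∈ S, Γ * y * Γ ∈ S)
    (hUS : U ∈ S) (hU : U * U = 1) (hUodd : Γ * U * Γ = -U)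
    (hx : ∀ y ∈ S, Γ * y * Γ = y → x * y = y * x) (hxU : x * U = U * x) :
    ∀ y ∈ S, x * y = y * x := by
  intro y hy
  have hΓΓ (a : A) : Γ * (Γ * a) = a := by rw [← mul_assoc, hΓ, one_mul]
  have hΓU : Γ * U = -(U * Γ) := mul_eq_neg_mul_of_conj_eq_neg hΓ hUodd
  have hΓUa (a : A) : Γ * (U * a) = -(U * (Γ * a)) := by
    rw [← mul_assoc, hΓU, neg_mul, mul_assoc]
  have heven : x * (y + Γ * y * Γ) = (y + Γ * y * Γ) * x := by
    refine hx _ (add_mem hy (hΓS y hy)) ?_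
    simp only [mul_add, add_mul, mul_assoc, hΓΓ, hΓ, mul_one]
    abel
  have hodd : x * (U * (y - Γ * y * Γ)) = U * (y - Γ * y * Γ) * x := by
    refine hx _ (mul_mem hUS (sub_mem hy (hΓS y hy))) ?_
    simp only [mul_sub, sub_mul, mul_assoc, hΓUa, neg_mul, hΓΓ, hΓ, mul_one]
    abel
  have hodd' : x * (y - Γ * y * Γ) = (y - Γ * y * Γ) * x := by
    calc x * (y - Γ * y * Γ) = U * (U * x) * (y - Γ * y * Γ) := by
          rw [← mul_assoc U U, hU, one_mul]
      _ = U * (x * (U * (y - Γ * y * Γ))) := by rw [← hxU]; simp only [mul_assoc]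
      _ = (y - Γ * y * Γ) * x := by
          rw [hodd, ← mul_assoc, ← mul_assoc, hU, one_mul]
  have htwo : (2 : ℂ) • (x * y) = (2 : ℂ) • (y * x) := by
    have := congrArg₂ (· + ·) heven hodd'
    simp only [mul_add, add_mul, mul_sub, sub_mul] at this
    rw [two_smul, two_smul]
    linear_combination (norm := abel) this
  exact smul_right_injective A (two_ne_zero' ℂ) htwo

/-- In a central graded algebra, conjugation by an odd involution sends every nontrivial central
idempotent of the even part to its complement. -/
theorem odd_conj_central_idempotent {A : Type*} [Ring A] [Algebra ℂ A]
    {S : Subalgebra ℂ A} {Γ U p : A} (hΓ : Γ * Γ = 1) (hΓS : ∀ y ∈ S, Γ * y * Γ ∈ S)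
    (hUS : U ∈ S) (hU : U * U = 1) (hUodd : Γ * U * Γ = -U)
    (hcentral : ∀ x ∈ S, Γ * x * Γ = x → (∀ y ∈ S, x * y = y * x) → ∃ c : ℂ, x = c • (1 : A))
    (hpS : p ∈ S) (hpeven : Γ * p * Γ = p) (hp2 : p * p = p)
    (hpcomm : ∀ y ∈ S, Γ * y * Γ = y → p * y = y * p) :
    p = 0 ∨ p = 1 ∨ U * p * U = 1 - p := by
  have hΓΓ (a : A) : Γ * (Γ * a) = a := by rw [← mul_assoc, hΓ, one_mul]
  have hUU (a : A) : U * (U * a) = a := by rw [← mul_assoc, hU, one_mul]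
  have hΓU : Γ * U = -(U * Γ) := mul_eq_neg_mul_of_conj_eq_neg hΓ hUodd
  have hconj_even {y : A} (hy : Γ * y * Γ = y) : Γ * (U * y * U) * Γ = U * y * U := by
    have hUΓ : U * Γ = -(Γ * U) := by rw [hΓU, neg_neg]
    calc Γ * (U * y * U) * Γ = Γ * U * y * (U * Γ) := by simp only [mul_assoc]
      _ = -(U * Γ) * y * -(Γ * U) := by rw [← hΓU, hUΓ]
      _ = U * (Γ * y * Γ) * U := by simp only [mul_assoc, neg_mul, mul_neg, neg_neg]
      _ = U * y * U := by rw [hy]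
  have hconj_mem {y : A} (hy : y ∈ S) : U * y * U ∈ S := mul_mem (mul_mem hUS hy) hUS
  set q := U * p * U with hq
  have hqS : q ∈ S := hconj_mem hpS
  have hqeven : Γ * q * Γ = q := hconj_even hpeven
  have hpU : p * U = U * q := by simp only [hq, mul_assoc, hUU]
  have hqU : q * U = U * p := by simp only [hq, mul_assoc, hU, mul_one]
  have hq2 : q * q = q := by
    calc q * q = U * (p * p) * U := by simp only [hq, mul_assoc, hUU]
      _ = q := by rw [hp2]
  have hqcomm : ∀ y ∈ S, Γ * y * Γ = y → q * y = y * q := by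
    intro y hy hyeven
    calc q * y = U * (p * (U * y * U)) * U := by simp only [hq, mul_assoc, hU, mul_one]
      _ = U * (U * y * U * p) * U := by rw [hpcomm _ (hconj_mem hy) (hconj_even hyeven)]
      _ = y * q := by simp only [hq, mul_assoc, hUU]
  have hpq : p * q = q * p := hpcomm q hqS hqeven
  have hmul : p * q = 0 ∨ p * q = 1 := by
    apply eq_zero_or_eq_one_of_mul_self_of_eq_smul_one
    · calc p * q * (p * q) = p * (q * p) * q := by simp only [mul_assoc]
        _ = p * p * (q * q) := by rw [← hpq]; simp only [mul_assoc]
        _ = p * q := by rw [hp2, hq2]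
    · have heven : Γ * (p * q) * Γ = p * q := by
        calc Γ * (p * q) * Γ = Γ * p * Γ * (Γ * q * Γ) := by simp only [mul_assoc, hΓΓ]
          _ = p * q := by rw [hpeven, hqeven]
      refine hcentral _ (mul_mem hpS hqS) heven
        (mul_comm_of_mul_comm_even_of_mul_comm_odd hΓ hΓS hUS hU hUodd ?_ ?_)
      · intro y hy hyeven
        rw [mul_assoc, hqcomm y hy hyeven, ← mul_assoc, hpcomm y hy hyeven, mul_assoc]
      · rw [mul_assoc, hqU, ← mul_assoc, hpU, mul_assoc, ← hpq]
  rcases hmul with hmul | hmul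
  · have hsum : p + q = 0 ∨ p + q = 1 := by
      apply eq_zero_or_eq_one_of_mul_self_of_eq_smul_one
      · simp only [add_mul, mul_add, ← hpq, hmul, hp2, hq2, add_zero, zero_add]
      · refine hcentral _ (add_mem hpS hqS) (by rw [mul_add, add_mul, hpeven, hqeven])
          (mul_comm_of_mul_comm_even_of_mul_comm_odd hΓ hΓS hUS hU hUodd ?_ ?_)
        · intro y hy hyeven
          rw [add_mul, mul_add, hpcomm y hy hyeven, hqcomm y hy hyeven]
        · rw [add_mul, mul_add, hpU, hqU, add_comm]
    rcases hsum with hsum | hsum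
    · left
      calc p = p * (p + q) := by rw [mul_add, hp2, hmul, add_zero]
        _ = 0 := by rw [hsum, mul_zero]
    · exact Or.inr (Or.inr (eq_sub_of_add_eq' hsum))
  · right; left
    calc p = p * (p * q) := by rw [hmul, mul_one]
      _ = 1 := by rw [← mul_assoc, hp2, hmul]


/-- **(from Lemma B.1 / Proposition 2.9 argument).** Let `M` be a von Neumann algebra
on a Hilbert space `H`, graded by a self-adjoint unitary `Γ` with `Γ M Γ = M`. Assume
`(M, Ad Γ)` is balanced, with odd self-adjoint unitary `U ∈ M`, and central. If there
is a projection `z` in the center of the even part `M⁰` with `z ≠ 0`, `z ≠ 1`, then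
every projection `s` in the center of `M⁰` satisfies `s ∈ {0, 1, z, 1 - z}`. -/
theorem central_projections_classified {H : Type*} [NormedAddCommGroup H]
    [InnerProductSpace ℂ H] [CompleteSpace H]
    (M : VonNeumannAlgebra H) (Γ : H →L[ℂ] H)
    (hΓsa : star Γ = Γ) (hΓu : Γ * Γ = 1)
    (hΓM : ∀ x : H →L[ℂ] H, x ∈ M ↔ Γ * x * Γ ∈ M)
    (U : H →L[ℂ] H) (hUM : U ∈ M) (hUsa : star U = U) (hUu : U * U = 1)
    (hUodd : Γ * U * Γ = -U)
    (hcentral : ∀ x : H →L[ℂ] H, x ∈ M → Γ * x * Γ = x →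
      (∀ y ∈ M, x * y = y * x) → ∃ c : ℂ, x = c • (1 : H →L[ℂ] H))
    (z : H →L[ℂ] H) (hzM : z ∈ M) (hzeven : Γ * z * Γ = z)
    (hzsa : star z = z) (hz2 : z * z = z)
    (hzcomm : ∀ y : H →L[ℂ] H, y ∈ M → Γ * y * Γ = y → z * y = y * z)
    (hz0 : z ≠ 0) (hz1 : z ≠ 1)
    (s : H →L[ℂ] H) (hsM : s ∈ M) (hseven : Γ * s * Γ = s)
    (hssa : star s = s) (hs2 : s * s = s)
    (hscomm : ∀ y : H →L[ℂ] H, y ∈ M → Γ * y * Γ = y → s * y = y * s) :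
    s = 0 ∨ s = 1 ∨ s = z ∨ s = 1 - z := by
  have hΓS : ∀ y ∈ M.toSubalgebra, Γ * y * Γ ∈ M.toSubalgebra := fun y hy => (hΓM y).mp hy
  have hdich {p : H →L[ℂ] H} (hpM : p ∈ M) (hpeven : Γ * p * Γ = p) (hp2 : p * p = p)
      (hpcomm : ∀ y ∈ M, Γ * y * Γ = y → p * y = y * p) :
      p = 0 ∨ p = 1 ∨ U * p * U = 1 - p :=
    odd_conj_central_idempotent (S := M.toSubalgebra) hΓu hΓS hUM hUu hUodd hcentral
      hpM hpeven hp2 hpcomm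
  rcases hdich hsM hseven hs2 hscomm with hs | hs | hs
  · exact Or.inl hs
  · exact Or.inr (Or.inl hs)
  have hz : U * z * U = 1 - z :=
    ((hdich hzM hzeven hz2 hzcomm).resolve_left hz0).resolve_left hz1
  have hsz : s * z = z * s := hscomm z hzM hzeven
  have hszeven : Γ * (s * z) * Γ = s * z := by
    calc Γ * (s * z) * Γ = Γ * s * (Γ * Γ) * z * Γ := by rw [hΓu, mul_one, mul_assoc Γ s z]
      _ = Γ * s * Γ * (Γ * z * Γ) := by simp only [mul_assoc]
      _ = s * z := by rw [hseven, hzeven]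
  have hszconj : U * (s * z) * U = 1 - s - z + s * z := by
    calc U * (s * z) * U = U * s * (U * U) * z * U := by rw [hUu, mul_one, mul_assoc U s z]
      _ = U * s * U * (U * z * U) := by simp only [mul_assoc]
      _ = 1 - s - z + s * z := by rw [hs, hz]; noncomm_ring
  have hszidem : s * z * (s * z) = s * z := by
    calc s * z * (s * z) = s * (z * s) * z := by simp only [mul_assoc]
      _ = s * s * (z * z) := by rw [← hsz]; simp only [mul_assoc]
      _ = s * z := by rw [hs2, hz2]
  have hszcomm : ∀ y ∈ M, Γ * y * Γ = y → s * z * y = y * (s * z) := by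
    intro y hy hyeven
    rw [mul_assoc, hzcomm y hy hyeven, ← mul_assoc, hscomm y hy hyeven, mul_assoc]
  rcases hdich (mul_mem hsM hzM) hszeven hszidem hszcomm with h | h | h
  · right; right; right
    rw [h, mul_zero, zero_mul, add_zero, sub_right_comm] at hszconj
    exact (sub_eq_zero.mp hszconj.symm).symm
  · refine absurd ?_ hz1
    calc z = s * z * z := by rw [h, one_mul]
      _ = 1 := by rw [mul_assoc, hz2, h]
  · right; right; left
    have htwo : s * z + s * z = s + z := by
      rw [hszconj] at h
      linear_combination (norm := abel) h
    have hleft : s * z = s := by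
      have := congrArg (s * ·) htwo
      simp only [mul_add, ← mul_assoc, hs2] at this
      exact add_right_cancel this
    have hright : s * z = z := by
      rw [hleft] at htwo
      rw [hleft]
      exact add_left_cancel htwo
    exact hleft.symm.trans hright
end

section
/- Let H = ℓ²(ℤ²;ℂ) with standard orthonormal basis {δ_{(x,y)} : (x,y) ∈ ℤ²}. Let K ⊆ H be the closed subspace spanned by the vectors δ_{(2x,y)} + i·δ_{(2x+1,y)} for x ∈ ℤ and y ∈ ℤ∖{0}, together with the vectors δ_{(2x−1,0)} + i·δ_{(2x,0)} for x ∈ ℤ. Let ϑ : H → H be the self-adjoint unitary determined by ϑ δ_{(x,y)} = δ_{(x,y)} if x ≤ −1 and ϑ δ_{(x,y)} = −δ_{(x,y)} if x ≥ 0. Then the intersection of K with the orthogonal complement of ϑ(K) is exactly the one-dimensional subspace spanned by δ_{(−1,0)} + i·δ_{(0,0)}. -/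
noncomputable section

/-- The Hilbert space `ℓ²(ℤ²; ℂ)`. -/
abbrev Hsp : Type := lp (fun _ : ℤ × ℤ => ℂ) 2

/-- The standard basis vector `δ_{(x,y)}` of `ℓ²(ℤ²; ℂ)`. -/
def δvec (x y : ℤ) : Hsp := lp.single 2 (x, y) 1

/-- The generating set of `K`: the vectors `δ_{(2x,y)} + i·δ_{(2x+1,y)}` for `x ∈ ℤ`,
`y ∈ ℤ ∖ {0}`, together with the vectors `δ_{(2x−1,0)} + i·δ_{(2x,0)}` for `x ∈ ℤ`. -/
def genSet : Set Hsp :=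
  {v | ∃ x y : ℤ, y ≠ 0 ∧ v = δvec (2 * x) y + Complex.I • δvec (2 * x + 1) y} ∪
    {v | ∃ x : ℤ, v = δvec (2 * x - 1) 0 + Complex.I • δvec (2 * x) 0}

/-- The closed subspace `K` spanned by `genSet`. -/
def Ksub : Submodule ℂ Hsp := (Submodule.span ℂ genSet).topologicalClosure

open scoped InnerProductSpace

theorem inner_δvec (a b : ℤ) (v : Hsp) : ⟪δvec a b, v⟫_ℂ = v (a, b) := by
  simp [δvec, lp.inner_single_left]

theorem δvec_apply (a b c d : ℤ) :
    (δvec a b : Hsp) (c, d) = if c = a ∧ d = b then 1 else 0 := by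
  simp [δvec, lp.single_apply, Pi.single_apply]

theorem inner_pair (a b c d : ℤ) (v : Hsp) :
    ⟪δvec a b + Complex.I • δvec c d, v⟫_ℂ = v (a, b) - Complex.I * v (c, d) := by
  rw [inner_add_left, inner_smul_left, inner_δvec, inner_δvec, Complex.conj_I]
  ring

theorem pair_apply (a b c d e f : ℤ) :
    (δvec a b + Complex.I • δvec c d : Hsp) (e, f) =
      (if e = a ∧ f = b then 1 else 0) + Complex.I * (if e = c ∧ f = d then 1 else 0) := by
  rw [lp.coeFn_add, Pi.add_apply, lp.coeFn_smul, Pi.smul_apply, δvec_apply, δvec_apply,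
    smul_eq_mul]

theorem inner_eq_zero_of_mem_Ksub {w v : Hsp} (hw : ∀ g ∈ genSet, ⟪w, g⟫_ℂ = 0)
    (hv : v ∈ Ksub) : ⟪w, v⟫_ℂ = 0 := by
  have h : Ksub ≤ (Submodule.span ℂ {w})ᗮ :=
    Submodule.topologicalClosure_minimal _
      (Submodule.span_le.2 fun g hg =>
        Submodule.mem_orthogonal_singleton_iff_inner_right.2 (hw g hg))
      (Submodule.isClosed_orthogonal _)
  exact Submodule.mem_orthogonal_singleton_iff_inner_right.1 (h hv)

theorem apply_odd_of_mem_Ksub {v : Hsp} (hv : v ∈ Ksub) (x y : ℤ) (hy : y ≠ 0) :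
    v (2 * x + 1, y) = Complex.I * v (2 * x, y) := by
  have h := inner_eq_zero_of_mem_Ksub
    (w := δvec (2 * x + 1) y + Complex.I • δvec (2 * x) y) ?_ hv
  · rw [inner_pair] at h
    exact sub_eq_zero.1 h
  · rintro g (⟨a, b, hb, rfl⟩ | ⟨a, rfl⟩)
    · rw [inner_pair, pair_apply, pair_apply]
      have h1 : ¬ (2 * x + 1 = 2 * a) := by omega
      have h2 : ¬ (2 * x = 2 * a + 1) := by omega
      simp [h1, h2]
    · rw [inner_pair, pair_apply, pair_apply]
      simp [hy]

theorem apply_even_zero_of_mem_Ksub {v : Hsp} (hv : v ∈ Ksub) (x : ℤ) :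
    v (2 * x, 0) = Complex.I * v (2 * x - 1, 0) := by
  have h := inner_eq_zero_of_mem_Ksub
    (w := δvec (2 * x) 0 + Complex.I • δvec (2 * x - 1) 0) ?_ hv
  · rw [inner_pair] at h
    exact sub_eq_zero.1 h
  · rintro g (⟨a, b, hb, rfl⟩ | ⟨a, rfl⟩)
    · rw [inner_pair, pair_apply, pair_apply]
      simp [hb.symm]
    · rw [inner_pair, pair_apply, pair_apply]
      have h1 : ¬ (2 * x = 2 * a - 1) := by omega
      have h2 : ¬ (2 * x - 1 = 2 * a) := by omega
      simp [h1, h2]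

theorem genSet_subset_Ksub : genSet ⊆ Ksub := fun _ hg =>
  Submodule.le_topologicalClosure _ (Submodule.subset_span hg)

/-- A vector `(p, I * p)` orthogonal to `(1, I)` vanishes. -/
theorem eq_zero_and_eq_zero_of_eq_I_mul {p q : ℂ} (h : q = Complex.I * p)
    (h' : p - Complex.I * q = 0) : p = 0 ∧ q = 0 := by
  have hp : p = 0 := by
    linear_combination (1 / 2) * h' + (Complex.I / 2) * h + (p / 2) * Complex.I_mul_I
  exact ⟨hp, by rw [h, hp, mul_zero]⟩

/-- **(Section 4 computation, `q ∧ (1 − ϑ q ϑ*) = q₀`).** For the self-adjoint unitary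
`ϑ` with `ϑ δ_{(x,y)} = δ_{(x,y)}` for `x ≤ −1` and `ϑ δ_{(x,y)} = −δ_{(x,y)}` for
`x ≥ 0`, the intersection of `K` with the orthogonal complement of `ϑ(K)` is exactly
the one-dimensional subspace spanned by `δ_{(−1,0)} + i·δ_{(0,0)}`. -/
theorem inter_orthogonal_eq_span (θ : Hsp →L[ℂ] Hsp)
    (hsa : star θ = θ) (hu : θ * θ = 1)
    (hθ : ∀ x y : ℤ, θ (δvec x y) = if x ≤ -1 then δvec x y else -δvec x y) :
    Ksub ⊓ (Ksub.map (θ : Hsp →ₗ[ℂ] Hsp))ᗮ =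
      Submodule.span ℂ {δvec (-1) 0 + Complex.I • δvec 0 0} := by
  apply le_antisymm
  · rintro v ⟨hv, hv'⟩
    have horth : ∀ g ∈ genSet, ⟪θ g, v⟫_ℂ = 0 := fun g hg =>
      (Submodule.mem_orthogonal _ _).1 hv' _ ⟨g, genSet_subset_Ksub hg, rfl⟩
    have hpair : ∀ a b c : ℤ, (a ≤ -1 ↔ c ≤ -1) →
        δvec a b + Complex.I • δvec c b ∈ genSet → v (a, b) - Complex.I * v (c, b) = 0 := by
      intro a b c hac hg
      have h := horth _ hg
      rw [map_add, map_smul, hθ, hθ] at h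
      by_cases hc : c ≤ -1
      · rwa [if_pos hc, if_pos (hac.2 hc), inner_pair] at h
      · rwa [if_neg hc, if_neg (mt hac.1 hc), smul_neg, ← neg_add, inner_neg_left, neg_eq_zero,
          inner_pair] at h
    have hoff : ∀ x y : ℤ, y ≠ 0 → v (2 * x, y) = 0 ∧ v (2 * x + 1, y) = 0 := fun x y hy =>
      eq_zero_and_eq_zero_of_eq_I_mul (apply_odd_of_mem_Ksub hv x y hy)
        (hpair _ _ _ (by omega) (Or.inl ⟨x, y, hy, rfl⟩))
    have hline : ∀ x : ℤ, x ≠ 0 → v (2 * x - 1, 0) = 0 ∧ v (2 * x, 0) = 0 := fun x hx =>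
      eq_zero_and_eq_zero_of_eq_I_mul (apply_even_zero_of_mem_Ksub hv x)
        (hpair _ _ _ (by omega) (Or.inr ⟨x, rfl⟩))
    have h0 : v (0, 0) = Complex.I * v (-1, 0) := by
      simpa using apply_even_zero_of_mem_Ksub hv 0
    refine Submodule.mem_span_singleton.2 ⟨v (-1, 0), lp.ext (funext ?_)⟩
    rintro ⟨x, y⟩
    rw [lp.coeFn_smul, Pi.smul_apply, pair_apply, smul_eq_mul]
    by_cases hy : y = 0
    · subst hy
      by_cases hx : x = -1
      · subst hx; simp
      by_cases hx' : x = 0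
      · subst hx'; simp [h0, mul_comm]
      have : v (x, 0) = 0 := by
        rcases Int.even_or_odd' x with ⟨k, rfl | rfl⟩
        · exact (hline k (by omega)).2
        · have h := (hline (k + 1) (by omega)).1
          rwa [show 2 * (k + 1) - 1 = 2 * k + 1 by ring] at h
      simp [hx, hx', this]
    · have : v (x, y) = 0 := by
        rcases Int.even_or_odd' x with ⟨k, rfl | rfl⟩
        · exact (hoff k y hy).1
        · exact (hoff k y hy).2
      simp [hy, this]
  · rw [Submodule.span_singleton_le_iff_mem]
    refine ⟨genSet_subset_Ksub (Or.inr ⟨0, by simp⟩), ?_⟩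
    rw [SetLike.mem_coe, Submodule.mem_orthogonal']
    rintro _ ⟨k, hk, rfl⟩
    have hk0 : k (0, 0) = Complex.I * k (-1, 0) := by
      simpa using apply_even_zero_of_mem_Ksub hk 0
    have hadj : ContinuousLinearMap.adjoint θ = θ := hsa
    rw [ContinuousLinearMap.coe_coe, ← ContinuousLinearMap.adjoint_inner_left, hadj, map_add,
      map_smul, hθ, hθ, if_pos le_rfl, if_neg (by norm_num), inner_add_left, inner_smul_left,
      inner_neg_left, inner_δvec, inner_δvec, hk0, Complex.conj_I]
    linear_combination k (-1, 0) * Complex.I_mul_I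
end
end
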